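/- arXiv:2106.08738 — 3 statements merged into one kernel-verified Lean document; each statement's English description precedes it below -/
import Mathlib

section
/- Suppose M < N. Then the polynomial P has exactly M roots in ℂ, all of them real and simple, and when listed in increasing order as μ₁ < μ₂ < ⋯ < μ_M they strictly interlace the numbers λ₁ < ⋯ < λ_M with 0 below: 0 < μ₁ < λ₁ < μ₂ < λ₂ < ⋯ < λ_{M−1} < μ_M < λ_M. -/
open Finset

open Polynomial in
lemma degree_prod_C_sub_X {ι R : Type*} [CommRing R] [IsDomain R] (s : Finset ι) (a : ι → R) :
    (∏ k ∈ s, (C (a k) - X)).degree = (s.card : WithBot ℕ) := by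
  have h : ∀ k, (C (a k) - X : R[X]).degree = 1 := fun k => by
    rw [← degree_neg, neg_sub, degree_X_sub_C]
  simp [degree_prod, h]

open Polynomial in
lemma leadingCoeff_prod_C_sub_X {ι R : Type*} [CommRing R] [IsDomain R] (s : Finset ι)
    (a : ι → R) : (∏ k ∈ s, (C (a k) - X)).leadingCoeff = (-1) ^ s.card := by
  have h : ∀ k, (C (a k) - X : R[X]).leadingCoeff = -1 := fun k => by
    rw [← neg_sub, leadingCoeff_neg, leadingCoeff_X_sub_C]
  simp [leadingCoeff_prod, h]

open Polynomial in
/-- A degree-`|ι|` perturbation `∏ (aₖ - z) - c ∑ᵣ bᵣ ∏_{k ≠ r} (aₖ - z)` vanishing at the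
`|ι|` distinct points `mₖ` factors as `∏ (mₖ - z)`. -/
lemma prod_sub_sum_erase_eq_prod_of_roots {ι R : Type*} [Fintype ι] [DecidableEq ι] [CommRing R]
    [IsDomain R] (a b m : ι → R) (c : R) (hm : Function.Injective m)
    (hroot : ∀ j, (∏ k, (a k - m j)) - c * ∑ r, b r * ∏ k ∈ univ.erase r, (a k - m j) = 0)
    (z : R) :
    (∏ k, (a k - z)) - c * ∑ r, b r * ∏ k ∈ univ.erase r, (a k - z) = ∏ k, (m k - z) := by
  set A : R[X] := ∏ k, (C (a k) - X) with hA
  set B : R[X] := ∏ k, (C (m k) - X) with hB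
  set S : R[X] := C c * ∑ r, C (b r) * ∏ k ∈ univ.erase r, (C (a k) - X) with hS
  have hA0 : A ≠ 0 := by
    intro h
    have := degree_prod_C_sub_X univ a
    rw [← hA, h, degree_zero] at this
    exact absurd this.symm (WithBot.natCast_ne_bot _)
  have hAdeg : A.degree = (univ : Finset ι).card := degree_prod_C_sub_X _ _
  have hAB : (A - B).degree < (univ : Finset ι).card := by
    rw [← hAdeg]
    refine degree_sub_lt_left ?_ hA0 ?_
    · rw [hA, hB, degree_prod_C_sub_X, degree_prod_C_sub_X]
    · rw [hA, hB, leadingCoeff_prod_C_sub_X, leadingCoeff_prod_C_sub_X]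
  have hSdeg : S.degree < (univ : Finset ι).card := by
    rw [hS, ← smul_eq_C_mul]
    refine (degree_smul_le _ _).trans_lt ?_
    refine (Finset.sum_induction _ (fun p : R[X] => p.degree < (univ : Finset ι).card)
      (fun p q hp hq => (degree_add_le p q).trans_lt (max_lt hp hq))
      (by rw [degree_zero]; exact WithBot.bot_lt_coe _) ?_)
    intro r _
    rw [← smul_eq_C_mul]
    refine (degree_smul_le _ _).trans_lt ?_
    rw [degree_prod_C_sub_X]
    exact_mod_cast card_erase_lt_of_mem (mem_univ r)
  have hzero : A - B - S = 0 := by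
    refine eq_zero_of_degree_lt_of_eval_index_eq_zero univ hm.injOn
      ((degree_sub_le _ _).trans_lt (max_lt hAB hSdeg)) fun j _ => ?_
    have hBj : B.eval (m j) = 0 := by
      rw [hB, eval_prod]
      exact prod_eq_zero (mem_univ j) (by simp)
    have hj := hroot j
    simp only [eval_sub, hBj, hA, hS, eval_prod, eval_mul, eval_finsetSum, eval_C, eval_X]
    rw [sub_zero]
    exact hj
  have hz := congrArg (eval z) hzero
  simp only [eval_sub, hA, hB, hS, eval_prod, eval_mul, eval_finsetSum, eval_C, eval_X,
    eval_zero] at hz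
  linear_combination hz

lemma exists_root_mem_Ioo_of_mul_neg {f : ℝ → ℝ} (hf : Continuous f) {a b : ℝ} (hab : a < b)
    (h : f a * f b < 0) : ∃ x ∈ Set.Ioo a b, f x = 0 := by
  rcases mul_neg_iff.mp h with ⟨ha, hb⟩ | ⟨ha, hb⟩
  · exact intermediate_value_Ioo' hab.le hf.continuousOn ⟨hb, ha⟩
  · exact intermediate_value_Ioo hab.le hf.continuousOn ⟨ha, hb⟩

/-- If no `l k` lies strictly between the distinct values `l i` and `l j`, the products
`∏_{k ≠ i} (l k - l i)` and `∏_{k ≠ j} (l k - l j)` have opposite signs. -/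
lemma prod_erase_sub_mul_prod_erase_sub_neg {ι : Type*} [Fintype ι] [DecidableEq ι] (l : ι → ℝ)
    {i j : ι} (hij : l i ≠ l j) (h : ∀ k, k ≠ i → k ≠ j → 0 < (l k - l i) * (l k - l j)) :
    (∏ k ∈ univ.erase i, (l k - l i)) * ∏ k ∈ univ.erase j, (l k - l j) < 0 := by
  have hne : i ≠ j := fun e => hij (e ▸ rfl)
  rw [← mul_prod_erase (univ.erase i) _ (mem_erase.mpr ⟨hne.symm, mem_univ j⟩),
    ← mul_prod_erase (univ.erase j) _ (mem_erase.mpr ⟨hne, mem_univ i⟩),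
    erase_right_comm (a := j) (b := i)]
  have hp : 0 < ∏ k ∈ (univ.erase i).erase j, ((l k - l i) * (l k - l j)) :=
    prod_pos fun k hk => by
      simp only [mem_erase] at hk
      exact h k hk.2.1 hk.1
  rw [prod_mul_distrib] at hp
  have hs : 0 < (l i - l j) ^ 2 := by
    have := sub_ne_zero.mpr hij
    positivity
  nlinarith [mul_pos hs hp]

lemma prod_sub_sum_erase_at_node {ι : Type*} [Fintype ι] [DecidableEq ι] (l b : ι → ℝ) (c : ℝ)
    (j : ι) :
    (∏ k, (l k - l j)) - c * ∑ r, b r * ∏ k ∈ univ.erase r, (l k - l j)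
      = -(c * (b j * ∏ k ∈ univ.erase j, (l k - l j))) := by
  rw [prod_eq_zero (mem_univ j) (sub_self _), sum_eq_single j, zero_sub]
  · intro r _ hr
    rw [prod_eq_zero (mem_erase.mpr ⟨hr.symm, mem_univ j⟩) (sub_self _), mul_zero]
  · simp

/-- Suppose `M < N`. Then the polynomial
`P(z) = ∏ₖ (λₖ − z) − (1/N) Σᵣ λᵣ ∏_{k≠r} (λₖ − z)` has exactly `M` roots in `ℂ`, all of
them real and simple, and listed in increasing order as `μ₁ < ⋯ < μ_M` they strictly
interlace `λ₁ < ⋯ < λ_M` with `0` below: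
`0 < μ₁ < λ₁ < μ₂ < λ₂ < ⋯ < λ_{M−1} < μ_M < λ_M`. -/
theorem stmt0 (M N : ℕ) (hM : 0 < M) (hN : 0 < N) (hMN : M < N)
    (l : Fin M → ℝ) (hmono : StrictMono l) (hpos : ∀ k, 0 < l k) :
    ∃ μ : Fin M → ℝ,
      StrictMono μ ∧
      (∀ z : ℂ,
        (∏ k, ((l k : ℂ) - z)) -
            (1 / (N : ℂ)) * ∑ r, (l r : ℂ) * ∏ k ∈ Finset.univ.erase r, ((l k : ℂ) - z)
          = ∏ k, ((μ k : ℂ) - z)) ∧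
      0 < μ ⟨0, hM⟩ ∧
      (∀ k : Fin M, μ k < l k) ∧
      (∀ k : Fin M, ∀ h : (k : ℕ) + 1 < M, l k < μ ⟨(k : ℕ) + 1, h⟩) := by
  set c : ℝ := 1 / N with hc
  have hN' : (0 : ℝ) < N := by exact_mod_cast hN
  have hc0 : 0 < c := by positivity
  have hcM : c * M < 1 := by
    rw [hc, one_div, inv_mul_lt_iff₀ hN', mul_one]
    exact_mod_cast hMN
  set f : ℝ → ℝ := fun x =>
    (∏ k, (l k - x)) - c * ∑ r, l r * ∏ k ∈ univ.erase r, (l k - x) with hf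
  have hcont : Continuous f := by fun_prop
  have hnode : ∀ j, f (l j) = -(c * (l j * ∏ k ∈ univ.erase j, (l k - l j))) :=
    prod_sub_sum_erase_at_node l l c
  have hzero : 0 < f 0 := by
    have h0 : f 0 = (1 - c * M) * ∏ k, l k := by
      simp only [hf, sub_zero, mul_prod_erase univ l (mem_univ _), sum_const, card_univ,
        Fintype.card_fin, nsmul_eq_mul]
      ring
    rw [h0]
    exact mul_pos (by linarith) (prod_pos fun k _ => hpos k)
  have hfirst : f (l ⟨0, hM⟩) < 0 := by
    rw [hnode, neg_lt_zero]
    refine mul_pos hc0 (mul_pos (hpos _) (prod_pos fun k hk => sub_pos.mpr (hmono ?_)))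
    have hk0 := ne_of_mem_erase hk
    rw [Ne, Fin.ext_iff] at hk0
    exact Fin.lt_def.mpr (Nat.pos_of_ne_zero hk0)
  have hstep : ∀ i j : Fin M, (i : ℕ) + 1 = j → f (l i) * f (l j) < 0 := by
    intro i j hij
    have hlt : i < j := Fin.lt_def.mpr (by omega)
    have hneg := prod_erase_sub_mul_prod_erase_sub_neg l (hmono hlt).ne fun k hki hkj => by
      rw [Ne, Fin.ext_iff] at hki hkj
      rcases lt_or_gt_of_ne hki with h | h
      · exact mul_pos_of_neg_of_neg (sub_neg.mpr (hmono (Fin.lt_def.mpr h)))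
          (sub_neg.mpr (hmono (Fin.lt_def.mpr (by omega))))
      · exact mul_pos (sub_pos.mpr (hmono (Fin.lt_def.mpr h)))
          (sub_pos.mpr (hmono (Fin.lt_def.mpr (by omega))))
    have hcl : 0 < c ^ 2 * (l i * l j) := mul_pos (by positivity) (mul_pos (hpos i) (hpos j))
    rw [hnode, hnode]
    linarith [mul_neg_of_pos_of_neg hcl hneg]
  have hroot : ∀ j : Fin M, ∃ x, f x = 0 ∧ x < l j ∧ (0 < x) ∧
      ∀ i : Fin M, (i : ℕ) + 1 = j → l i < x := by
    intro j
    by_cases hj : (j : ℕ) = 0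
    · obtain rfl : j = ⟨0, hM⟩ := Fin.ext hj
      obtain ⟨x, hx, hfx⟩ := exists_root_mem_Ioo_of_mul_neg hcont (hpos _)
        (mul_neg_of_pos_of_neg hzero hfirst)
      exact ⟨x, hfx, hx.2, hx.1, fun i hi => absurd hi (Nat.succ_ne_zero _)⟩
    · have hlt : (j : ℕ) - 1 < M := by omega
      have hs : ((⟨(j : ℕ) - 1, hlt⟩ : Fin M) : ℕ) + 1 = j := by simp only; omega
      obtain ⟨x, hx, hfx⟩ := exists_root_mem_Ioo_of_mul_neg hcont
        (hmono (Fin.lt_def.mpr (by omega))) (hstep _ j hs)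
      refine ⟨x, hfx, hx.2, (hpos _).trans hx.1, fun i hi => ?_⟩
      obtain rfl : i = ⟨(j : ℕ) - 1, hlt⟩ := Fin.ext (by simp only; omega)
      exact hx.1
  choose μ hμf hμl hμ0 hlμ using hroot
  have hμmono : StrictMono μ := by
    intro i j hij
    have hij' := Fin.lt_def.mp hij
    have hlt : (j : ℕ) - 1 < M := by omega
    calc μ i < l i := hμl i
      _ ≤ l ⟨(j : ℕ) - 1, hlt⟩ := hmono.monotone (Fin.le_def.mpr (by simp only; omega))
      _ < μ j := hlμ j _ (by simp only; omega)
  refine ⟨μ, hμmono, fun z => ?_, hμ0 _, hμl, fun k h => hlμ _ k rfl⟩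
  refine prod_sub_sum_erase_eq_prod_of_roots (fun k => (l k : ℂ)) (fun k => (l k : ℂ))
    (fun k => (μ k : ℂ)) _ (Complex.ofReal_injective.comp hμmono.injective) (fun j => ?_) z
  have h := hμf j
  simp only [hf, hc] at h
  simpa using congrArg Complex.ofReal h
end

section
/- Let R be an M×M complex matrix, N a positive integer, U ⊆ ℂ an open set, z₀ ∈ U, and ω : U → ℂ a function that is complex differentiable at z₀ and such that for every z ∈ U the matrix R − ω(z)·I_M is invertible and z = ω(z)·(1 − (1/N)·tr(R·(R − ω(z)·I)^{-1})). If 1 − (1/N)·tr(R²·(R − ω(z₀)·I)^{-2}) ≠ 0, then ω′(z₀) = (1 − (1/N)·tr(R²·(R − ω(z₀)·I)^{-2}))^{-1}. -/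
open Matrix

theorem Matrix.nonsing_inv_neg {n α : Type*} [Fintype n] [DecidableEq n] [CommRing α]
    (A : Matrix n n α) : (-A)⁻¹ = -A⁻¹ := by
  have hone : (-1 : Matrix n n α)⁻¹ = -1 := Matrix.inv_eq_right_inv (by simp)
  rw [← mul_neg_one A, Matrix.mul_inv_rev, hone, neg_one_mul]

section Resolvent

attribute [local instance] Matrix.linftyOpNormedRing Matrix.linftyOpNormedAlgebra

theorem Matrix.hasDerivAt_trace_mul_inv_sub_smul_one {n : Type*} [Fintype n] [DecidableEq n]
    (A R : Matrix n n ℂ) {w : ℂ} (hw : IsUnit (R - w • (1 : Matrix n n ℂ))) :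
    HasDerivAt (fun x : ℂ => (A * (R - x • (1 : Matrix n n ℂ))⁻¹).trace)
      (A * ((R - w • (1 : Matrix n n ℂ))⁻¹) ^ 2).trace w := by
  have hmem : w ∈ resolventSet ℂ R := by
    rw [spectrum.mem_resolventSet_iff, Algebra.algebraMap_eq_smul_one, ← neg_sub]
    exact hw.neg
  have hres : ∀ x : ℂ, resolvent R x = -(R - x • (1 : Matrix n n ℂ))⁻¹ := fun x => by
    rw [resolvent, Algebra.algebraMap_eq_smul_one, ← neg_sub,
      ← Matrix.nonsing_inv_eq_ringInverse]
    exact Matrix.nonsing_inv_neg _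
  let L : Matrix n n ℂ →L[ℂ] ℂ := LinearMap.toContinuousLinearMap
    (-(Matrix.traceLinearMap n ℂ ℂ ∘ₗ LinearMap.mulLeft ℂ A))
  have hL : ∀ X, L X = -(A * X).trace := fun _ => rfl
  have h := L.hasFDerivAt.comp_hasDerivAt w (spectrum.hasDerivAt_resolvent_const_left hmem)
  have hfun : (fun x : ℂ => (A * (R - x • (1 : Matrix n n ℂ))⁻¹).trace) = L ∘ resolvent R := by
    funext x
    simp [hL, hres]
  rw [hfun]
  exact h.congr_deriv ((hL _).trans (by simp [hres]))

end Resolvent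

/-- The derivative of `w ↦ w (1 - c tr (R (R - w)⁻¹))` off the spectrum of `R`. -/
theorem Matrix.hasDerivAt_mul_one_sub_trace_mul_inv {n : Type*} [Fintype n] [DecidableEq n]
    (R : Matrix n n ℂ) (c : ℂ) {w : ℂ} (hw : IsUnit (R - w • (1 : Matrix n n ℂ))) :
    HasDerivAt (fun x : ℂ => x * (1 - c * (R * (R - x • (1 : Matrix n n ℂ))⁻¹).trace))
      (1 - c * (R ^ 2 * ((R - w • (1 : Matrix n n ℂ))⁻¹) ^ 2).trace) w := by
  have h := (hasDerivAt_id w).mul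
    (((Matrix.hasDerivAt_trace_mul_inv_sub_smul_one R R hw).const_mul c).const_sub 1)
  refine h.congr_deriv ?_
  have hcancel : (R - w • (1 : Matrix n n ℂ)) * (R - w • (1 : Matrix n n ℂ))⁻¹ = 1 :=
    Matrix.mul_nonsing_inv _ ((Matrix.isUnit_iff_isUnit_det _).mp hw)
  set Q := (R - w • (1 : Matrix n n ℂ))⁻¹
  have hRQ : R * Q = 1 + w • Q := by
    rw [Matrix.sub_mul, Matrix.smul_mul, Matrix.one_mul] at hcancel
    exact sub_eq_iff_eq_add.mp hcancel
  have key : R ^ 2 * Q ^ 2 = R * Q + w • (R * Q ^ 2) := by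
    calc R ^ 2 * Q ^ 2 = R * (R * Q) * Q := by simp only [pow_two, Matrix.mul_assoc]
      _ = R * (1 + w • Q) * Q := by rw [hRQ]
      _ = R * Q + w • (R * Q ^ 2) := by
        simp [Matrix.mul_add, Matrix.add_mul, pow_two, Matrix.mul_assoc]
  rw [key, Matrix.trace_add, Matrix.trace_smul, smul_eq_mul]
  simp only [id]
  ring

/-- Let `U ⊆ ℂ` be open, `z₀ ∈ U`, and let `ω : ℂ → ℂ` be complex
differentiable at `z₀` with `R − ω(z)·I` invertible and
`z = ω(z)·(1 − (1/N)·tr(R·(R − ω(z)·I)⁻¹))` for every `z ∈ U`. If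
`1 − (1/N)·tr(R²·(R − ω(z₀)·I)⁻²) ≠ 0`, then
`ω′(z₀) = (1 − (1/N)·tr(R²·(R − ω(z₀)·I)⁻²))⁻¹`. -/
theorem stmt11 {M : ℕ} (R : Matrix (Fin M) (Fin M) ℂ) (N : ℕ) (hN : 0 < N)
    (U : Set ℂ) (hU : IsOpen U) (z₀ : ℂ) (hz₀ : z₀ ∈ U) (ω : ℂ → ℂ)
    (hdiff : DifferentiableAt ℂ ω z₀)
    (hinv : ∀ z ∈ U, IsUnit (R - ω z • (1 : Matrix (Fin M) (Fin M) ℂ)))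
    (heq : ∀ z ∈ U,
      z = ω z * ((1 : ℂ) - (1 / (N : ℂ)) * Matrix.trace (R * (R - ω z • 1)⁻¹)))
    (hne : (1 : ℂ) - (1 / (N : ℂ)) * Matrix.trace (R ^ 2 * ((R - ω z₀ • 1)⁻¹) ^ 2) ≠ 0) :
    deriv ω z₀
      = ((1 : ℂ) - (1 / (N : ℂ)) * Matrix.trace (R ^ 2 * ((R - ω z₀ • 1)⁻¹) ^ 2))⁻¹ := by
  have hcomp := (Matrix.hasDerivAt_mul_one_sub_trace_mul_inv R (1 / (N : ℂ))
    (hinv z₀ hz₀)).comp z₀ hdiff.hasDerivAt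
  have hid := (hasDerivAt_id z₀).congr_of_eventuallyEq
    (Filter.eventually_of_mem (hU.mem_nhds hz₀) fun z hz => (heq z hz).symm)
  exact eq_inv_of_mul_eq_one_right (hcomp.unique hid)
end

section
/- Let R be an M×M complex matrix, N a positive integer, U ⊆ ℂ an open set, z₀ ∈ U with z₀ ≠ 0, and ω : U → ℂ a function that is complex differentiable at z₀ and such that for every z ∈ U the matrix R − ω(z)·I_M is invertible and z = ω(z)·(1 − (1/N)·tr(R·(R − ω(z)·I)^{-1})). Assume 1 − (1/N)·tr(R²·(R − ω(z₀)·I)^{-2}) ≠ 0, and set Q̄(z₀) = (ω(z₀)/z₀)·(R − ω(z₀)·I)^{-1}. Then ω(z₀) ≠ 0, 1 − z₀·(1/N)·tr(R·Q̄(z₀)²) ≠ 0, and (z₀/ω(z₀))·ω′(z₀) = (1 − z₀·(1/N)·tr(R·Q̄(z₀)²))^{-1}. -/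
open Matrix

open scoped Matrix.Norms.Operator in
/-- The derivative of `w ↦ tr (R (R - w I)⁻¹)` at a point where `R - w I` is invertible. -/
theorem hasDerivAt_trace_mul_resolvent {n : Type*} [Fintype n] [DecidableEq n]
    (R : Matrix n n ℂ) (w : ℂ) (hw : IsUnit (R - w • (1 : Matrix n n ℂ))) :
    HasDerivAt (fun v : ℂ => Matrix.trace (R * (R - v • (1 : Matrix n n ℂ))⁻¹))
      (Matrix.trace (R * ((R - w • (1 : Matrix n n ℂ))⁻¹) ^ 2)) w := by
  obtain ⟨u, hu⟩ := hw
  have hlin := ((hasDerivAt_id' w).smul_const (1 : Matrix n n ℂ)).const_sub R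
  rw [one_smul] at hlin
  have hinv : HasFDerivAt Ring.inverse
      (-ContinuousLinearMap.mulLeftRight ℂ (Matrix n n ℂ) ↑u⁻¹ ↑u⁻¹)
      (R - w • (1 : Matrix n n ℂ)) := hu ▸ hasFDerivAt_ringInverse u
  have hres := (hinv.comp_hasDerivAt w hlin).const_mul R
  have htr := ((Matrix.traceLinearMap n ℂ ℂ).toContinuousLinearMap.hasFDerivAt).comp_hasDerivAt
    w hres
  have hA : (R - w • (1 : Matrix n n ℂ))⁻¹ = ↑u⁻¹ := by
    rw [← hu, Matrix.coe_units_inv]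
  rw [hA, pow_two]
  simp only [Matrix.nonsing_inv_eq_ringInverse]
  refine htr.congr_deriv ?_
  change Matrix.trace (R * -((↑u⁻¹ : Matrix n n ℂ) * -1 * (↑u⁻¹ : Matrix n n ℂ))) =
    Matrix.trace (R * ((↑u⁻¹ : Matrix n n ℂ) * (↑u⁻¹ : Matrix n n ℂ)))
  rw [mul_neg_one, neg_mul, neg_neg]

/-- The resolvent identity `R² (R - w I)⁻² = R (R - w I)⁻¹ + w R (R - w I)⁻²`. -/
theorem sq_mul_resolvent_sq {n : Type*} [Fintype n] [DecidableEq n]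
    (R : Matrix n n ℂ) (w : ℂ) (hw : IsUnit (R - w • (1 : Matrix n n ℂ))) :
    R ^ 2 * ((R - w • (1 : Matrix n n ℂ))⁻¹) ^ 2 =
      R * (R - w • (1 : Matrix n n ℂ))⁻¹ + w • (R * ((R - w • (1 : Matrix n n ℂ))⁻¹) ^ 2) := by
  have h := Matrix.mul_nonsing_inv _ ((Matrix.isUnit_iff_isUnit_det _).mp hw)
  set A := (R - w • (1 : Matrix n n ℂ))⁻¹
  have hRA : R * A = 1 + w • A := by
    rw [sub_mul, smul_mul_assoc, one_mul] at h
    exact sub_eq_iff_eq_add.mp h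
  calc R ^ 2 * A ^ 2 = R * (R * A) * A := by simp only [pow_two, mul_assoc]
    _ = R * A + w • (R * A ^ 2) := by
      nth_rw 1 [hRA]
      rw [mul_add, add_mul, mul_one, mul_smul_comm, smul_mul_assoc, pow_two, mul_assoc]

/-- Under the hypotheses of Statement 11, with `z₀ ≠ 0` and
`Q̄(z₀) = (ω(z₀)/z₀)·(R − ω(z₀)·I)⁻¹`: `ω(z₀) ≠ 0`,
`1 − z₀·(1/N)·tr(R·Q̄(z₀)²) ≠ 0`, and
`(z₀/ω(z₀))·ω′(z₀) = (1 − z₀·(1/N)·tr(R·Q̄(z₀)²))⁻¹`. -/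
theorem stmt12 {M : ℕ} (R : Matrix (Fin M) (Fin M) ℂ) (N : ℕ) (hN : 0 < N)
    (U : Set ℂ) (hU : IsOpen U) (z₀ : ℂ) (hz₀ : z₀ ∈ U) (hz₀ne : z₀ ≠ 0) (ω : ℂ → ℂ)
    (hdiff : DifferentiableAt ℂ ω z₀)
    (hinv : ∀ z ∈ U, IsUnit (R - ω z • (1 : Matrix (Fin M) (Fin M) ℂ)))
    (heq : ∀ z ∈ U,
      z = ω z * ((1 : ℂ) - (1 / (N : ℂ)) * Matrix.trace (R * (R - ω z • 1)⁻¹)))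
    (hne : (1 : ℂ) - (1 / (N : ℂ)) * Matrix.trace (R ^ 2 * ((R - ω z₀ • 1)⁻¹) ^ 2) ≠ 0) :
    ω z₀ ≠ 0 ∧
    (1 : ℂ) - z₀ * ((1 / (N : ℂ))
        * Matrix.trace (R * ((ω z₀ / z₀) • (R - ω z₀ • 1)⁻¹) ^ 2)) ≠ 0 ∧
    (z₀ / ω z₀) * deriv ω z₀
      = ((1 : ℂ) - z₀ * ((1 / (N : ℂ))
          * Matrix.trace (R * ((ω z₀ / z₀) • (R - ω z₀ • 1)⁻¹) ^ 2)))⁻¹ := by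
  have hw₀ := hinv z₀ hz₀
  have hz := heq z₀ hz₀
  have hω : ω z₀ ≠ 0 := fun h => hz₀ne (by rw [hz, h, zero_mul])
  have hder := hdiff.hasDerivAt.mul
    ((((hasDerivAt_trace_mul_resolvent R (ω z₀) hw₀).comp z₀ hdiff.hasDerivAt).const_mul
      (1 / (N : ℂ))).const_sub 1)
  have hid := hder.congr_of_eventuallyEq
    (show (fun z : ℂ => z) =ᶠ[nhds z₀] _ from
      Filter.eventually_of_mem (hU.mem_nhds hz₀) heq)
  have hone := hid.unique (hasDerivAt_id' z₀)
  simp only [Function.comp_apply] at hone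
  rw [sq_mul_resolvent_sq R (ω z₀) hw₀, Matrix.trace_add, Matrix.trace_smul, smul_eq_mul] at hne
  rw [smul_pow, mul_smul_comm, Matrix.trace_smul, smul_eq_mul]
  generalize Matrix.trace (R * (R - ω z₀ • 1)⁻¹) = t at *
  generalize Matrix.trace (R * ((R - ω z₀ • 1)⁻¹) ^ 2) = s at *
  have hkey : 1 - z₀ * (1 / (N : ℂ) * ((ω z₀ / z₀) ^ 2 * s)) =
      ω z₀ / z₀ * (1 - 1 / (N : ℂ) * (t + ω z₀ * s)) := by
    have hsq : z₀ * (ω z₀ / z₀) ^ 2 = ω z₀ / z₀ * ω z₀ := by field_simp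
    have hdiv : 1 = ω z₀ / z₀ * (1 - 1 / (N : ℂ) * t) := by
      rw [div_mul_eq_mul_div, ← hz, div_self hz₀ne]
    linear_combination hdiv - 1 / (N : ℂ) * s * hsq
  have hnz : 1 - z₀ * (1 / (N : ℂ) * ((ω z₀ / z₀) ^ 2 * s)) ≠ 0 := by
    rw [hkey]
    exact mul_ne_zero (div_ne_zero hω hz₀ne) hne
  refine ⟨hω, hnz, eq_inv_of_mul_eq_one_left ?_⟩
  rw [hkey]
  have hcancel : z₀ / ω z₀ * (ω z₀ / z₀) = 1 := by field_simp
  linear_combination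
    deriv ω z₀ * (1 - 1 / (N : ℂ) * (t + ω z₀ * s)) * hcancel + hone
end
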